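/- arXiv:2112.07387 — 2 statements merged into one kernel-verified Lean document; each statement's English description precedes it below -/
import Mathlib

section
/- Let n ∈ ℕ (n ≥ 1) and let I be a proper open subinterval of ℝ. If f : I → ℝ is Wright convex of order n, then there exist a function g : I → ℝ that is convex of order n on I and a function P : ℝ → ℝ satisfying the Fréchet equation Δ_h^{n+1} P(x) = 0 for all h > 0 and x ∈ ℝ (i.e., P is a polynomial function of degree at most n), such that f(x) = g(x) + P(x) for all x ∈ I. -/
open Finset

/-- The difference operator `Δ_h`. -/
noncomputable def dOp (h : ℝ) (f : ℝ → ℝ) : ℝ → ℝ := fun x => f (x + h) - f x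

/-- Iterated difference operator `Δ_{h_1} ⋯ Δ_{h_k}` for a list `[h_1, …, h_k]`. -/
noncomputable def dList (l : List ℝ) (f : ℝ → ℝ) : ℝ → ℝ := l.foldr dOp f

/-- The divided difference `[x_0, …, x_m; f]`. -/
noncomputable def divDiff (m : ℕ) (x : Fin (m + 1) → ℝ) (f : ℝ → ℝ) : ℝ :=
  ∑ i, f (x i) / ∏ j ∈ Finset.univ.erase i, (x i - x j)

/-- `I` is a proper open subinterval of the real line. -/
def ProperOpenInterval (I : Set ℝ) : Prop :=
  IsOpen I ∧ I.OrdConnected ∧ I.Nonempty ∧ I ≠ Set.univ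

/-- A real number which is rational. -/
def IsRatR (x : ℝ) : Prop := ∃ q : ℚ, (q : ℝ) = x

/-- `f` is Wright convex of order `n` on `I`. -/
def WrightConvexOrder (n : ℕ) (I : Set ℝ) (f : ℝ → ℝ) : Prop :=
  ∀ l : List ℝ, l.length = n + 1 → (∀ h ∈ l, 0 < h) →
    ∀ x : ℝ, x ∈ I → x + l.sum ∈ I → 0 ≤ dList l f x

/-- `f` is Jensen convex of order `n` on `I`. -/
def JensenConvexOrder (n : ℕ) (I : Set ℝ) (f : ℝ → ℝ) : Prop :=
  ∀ h : ℝ, 0 < h → ∀ x : ℝ, x ∈ I → x + (n + 1) * h ∈ I → 0 ≤ (dOp h)^[n + 1] f x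

/-- `f` is convex of order `n` on `I`. -/
def ConvexOrder (n : ℕ) (I : Set ℝ) (f : ℝ → ℝ) : Prop :=
  ∀ x : Fin (n + 2) → ℝ, Function.Injective x → (∀ i, x i ∈ I) →
    0 ≤ divDiff (n + 1) x f

/-- The divided difference of the values `φ` with respect to the nodes `v i`, `i ∈ s`. -/
noncomputable def finsetDivDiff {ι : Type*} [DecidableEq ι] (s : Finset ι) (v φ : ι → ℝ) : ℝ :=
  ∑ i ∈ s, φ i / ∏ j ∈ s.erase i, (v i - v j)

section FinsetDivDiff

variable {ι : Type*} [DecidableEq ι]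

theorem finsetDivDiff_map {κ : Type*} [DecidableEq κ] (s : Finset κ) (e : κ ↪ ι) (v φ : ι → ℝ) :
    finsetDivDiff (s.map e) v φ = finsetDivDiff s (v ∘ e) (φ ∘ e) := by
  simp only [finsetDivDiff, Finset.sum_map, ← Finset.map_erase, Finset.prod_map,
    Function.comp_apply]

theorem finsetDivDiff_congr {s : Finset ι} {v φ ψ : ι → ℝ} (h : ∀ i ∈ s, φ i = ψ i) :
    finsetDivDiff s v φ = finsetDivDiff s v ψ :=
  Finset.sum_congr rfl fun i hi => by rw [h i hi]

theorem finsetDivDiff_neg (s : Finset ι) (v φ : ι → ℝ) :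
    finsetDivDiff s v (fun i => -φ i) = -finsetDivDiff s v φ := by
  simp [finsetDivDiff, neg_div]

theorem finsetDivDiff_sub (s : Finset ι) (v φ ψ : ι → ℝ) :
    finsetDivDiff s v (fun i => φ i - ψ i) = finsetDivDiff s v φ - finsetDivDiff s v ψ := by
  simp [finsetDivDiff, sub_div]

theorem finsetDivDiff_singleton (i : ι) (v φ : ι → ℝ) : finsetDivDiff {i} v φ = φ i := by
  simp [finsetDivDiff]

/-- The recursion satisfied by divided differences. -/
theorem finsetDivDiff_insert_insert {v : ι → ℝ} (hv : Function.Injective v) (φ : ι → ℝ)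
    {a b : ι} {t : Finset ι} (hab : a ≠ b) (ha : a ∉ t) (hb : b ∉ t) :
    (v a - v b) * finsetDivDiff (insert a (insert b t)) v φ =
      finsetDivDiff (insert a t) v φ - finsetDivDiff (insert b t) v φ := by
  have hne : ∀ {i j : ι}, i ≠ j → v i - v j ≠ 0 := fun h => sub_ne_zero.2 (hv.ne h)
  have ha' : a ∉ insert b t := by simp [hab, ha]
  have hb' : b ∉ insert a t := by simp [hab.symm, hb]
  have hprod : ∀ i ∉ t, ∏ j ∈ t, (v i - v j) ≠ 0 := fun i hi =>
    Finset.prod_ne_zero_iff.2 fun j hj => hne fun h => hi (h ▸ hj)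
  have hta : (insert a (insert b t)).erase a = insert b t := Finset.erase_insert ha'
  have htb : (insert a (insert b t)).erase b = insert a t := by
    rw [Finset.insert_comm, Finset.erase_insert hb']
  unfold finsetDivDiff
  rw [Finset.sum_insert ha', Finset.sum_insert hb, Finset.sum_insert ha, Finset.sum_insert hb,
    hta, htb, Finset.erase_insert ha, Finset.erase_insert hb, Finset.prod_insert hb,
    Finset.prod_insert ha]
  have hsum : (v a - v b) * ∑ i ∈ t, φ i / ∏ j ∈ (insert a (insert b t)).erase i, (v i - v j) =
      ∑ i ∈ t, φ i / ∏ j ∈ (insert a t).erase i, (v i - v j) -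
        ∑ i ∈ t, φ i / ∏ j ∈ (insert b t).erase i, (v i - v j) := by
    rw [Finset.mul_sum, ← Finset.sum_sub_distrib]
    refine Finset.sum_congr rfl fun i hi => ?_
    have hia : i ≠ a := fun h => ha (h ▸ hi)
    have hib : i ≠ b := fun h => hb (h ▸ hi)
    rw [Finset.erase_insert_of_ne hia.symm, Finset.erase_insert_of_ne hia.symm,
      Finset.erase_insert_of_ne hib.symm, Finset.prod_insert, Finset.prod_insert,
      Finset.prod_insert]
    · have h1 := hne hia
      have h2 := hne hib
      have h3 : ∏ j ∈ t.erase i, (v i - v j) ≠ 0 :=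
        Finset.prod_ne_zero_iff.2 fun j hj => hne (Finset.ne_of_mem_erase hj).symm
      field_simp
      ring
    · simp [ha]
    · simp [hb]
    · simp [hab, ha]
  rw [mul_add, mul_add, hsum]
  have h1 := hprod a ha
  have h2 := hprod b hb
  have h3 := hne hab
  have h4 := hne hab.symm
  have e1 : (v a - v b) * (φ a / ((v a - v b) * ∏ j ∈ t, (v a - v j))) =
      φ a / ∏ j ∈ t, (v a - v j) := by field_simp
  have e2 : (v a - v b) * (φ b / ((v b - v a) * ∏ j ∈ t, (v b - v j))) =
      -(φ b / ∏ j ∈ t, (v b - v j)) := by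
    rw [← neg_sub (v b) (v a)]
    field_simp
  rw [e1, e2]
  ring

/-- Effect on a divided difference of exchanging one node. -/
theorem finsetDivDiff_sub_exchange {v : ι → ℝ} (hv : Function.Injective v) (φ : ι → ℝ)
    {x y : ι} {s : Finset ι} (hx : x ∈ s) (hy : y ∉ s) :
    finsetDivDiff s v φ - finsetDivDiff (insert y (s.erase x)) v φ =
      (v x - v y) * finsetDivDiff (insert y s) v φ := by
  have hxy : x ≠ y := fun h => hy (h ▸ hx)
  have := finsetDivDiff_insert_insert hv φ hxy (Finset.notMem_erase x s)
    (fun h => hy (Finset.mem_of_mem_erase h))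
  rw [Finset.insert_comm, Finset.insert_erase hx] at this
  exact this.symm

theorem card_and_sdiff_exchange {x y : ι} {s c : Finset ι} (hx : x ∈ s \ c) (hy : y ∈ c \ s) :
    (insert y (s.erase x)).card = s.card ∧ insert y (s.erase x) \ c = (s \ c).erase x ∧
      c \ insert y (s.erase x) = (c \ s).erase y ∧ ((s \ c).erase x).card + 1 = (s \ c).card := by
  simp only [Finset.mem_sdiff] at hx hy
  refine ⟨?_, ?_, ?_, Finset.card_erase_add_one (by simp [hx])⟩
  · rw [Finset.card_insert_of_notMem (by simp [hy.2]), Finset.card_erase_add_one hx.1]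
  · ext z
    simp only [Finset.mem_sdiff, Finset.mem_insert, Finset.mem_erase]
    grind
  · ext z
    simp only [Finset.mem_sdiff, Finset.mem_insert, Finset.mem_erase]
    grind

/-- If the divided differences on `m + 1` nodes in `A` are nonnegative, then the divided
differences on `m` nodes in `A` increase with the nodes. -/
theorem finsetDivDiff_le_of_nonneg {v : ι → ℝ} (hv : Function.Injective v) (φ : ι → ℝ)
    {A : Set ι} {m : ℕ}
    (hA : ∀ s : Finset ι, s.card = m + 1 → ↑s ⊆ A → 0 ≤ finsetDivDiff s v φ)
    (c : Finset ι) (hc : c.card = m) (hcA : ↑c ⊆ A) (k : ℕ) :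
    ∀ s : Finset ι, (s \ c).card = k → s.card = m → ↑s ⊆ A →
      (∀ x ∈ s \ c, ∀ y ∈ c \ s, v x ≤ v y) → finsetDivDiff s v φ ≤ finsetDivDiff c v φ := by
  induction k with
  | zero =>
    intro s hk hs _ _
    rw [Finset.card_eq_zero, Finset.sdiff_eq_empty_iff_subset] at hk
    rw [Finset.eq_of_subset_of_card_le hk (by omega)]
  | succ k ih =>
    intro s hk hs hsA hle
    obtain ⟨x, hx⟩ : (s \ c).Nonempty := Finset.card_pos.1 (by omega)
    obtain ⟨y, hy⟩ : (c \ s).Nonempty := Finset.card_pos.1 (by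
      rw [Finset.card_sdiff_comm (hc.trans hs.symm)]; omega)
    obtain ⟨e1, e2, e3, e4⟩ := card_and_sdiff_exchange hx hy
    have hxs := (Finset.mem_sdiff.1 hx).1
    have hyc := (Finset.mem_sdiff.1 hy).1
    have hys := (Finset.mem_sdiff.1 hy).2
    have h1 := ih (insert y (s.erase x)) (by rw [e2]; omega) (by omega)
      (by
        intro z hz
        rcases Finset.mem_insert.1 (Finset.mem_coe.1 hz) with rfl | hz
        · exact hcA hyc
        · exact hsA (Finset.mem_of_mem_erase hz))
      (by
        rw [e2, e3]
        exact fun z hz w hw => hle z (Finset.mem_of_mem_erase hz) w (Finset.mem_of_mem_erase hw))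
    have h2 := finsetDivDiff_sub_exchange hv φ hxs hys
    have h3 := hA (insert y s) (by rw [Finset.card_insert_of_notMem hys, hs]) (by
      rw [Finset.coe_insert]
      exact Set.insert_subset (hcA hyc) hsA)
    have h4 := mul_nonneg (sub_nonneg.2 (hle x hx y hy)) h3
    linarith

/-- If the divided differences on `m + 1` nodes in a bounded set `A` are bounded, then so are the
variations of the divided differences on `m` nodes in `A`. -/
theorem abs_finsetDivDiff_sub_le {v : ι → ℝ} (hv : Function.Injective v) (φ : ι → ℝ)
    {A : Set ι} {m : ℕ} {M R : ℝ}
    (hA : ∀ s : Finset ι, s.card = m + 1 → ↑s ⊆ A → |finsetDivDiff s v φ| ≤ M)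
    (hR : ∀ x ∈ A, ∀ y ∈ A, |v x - v y| ≤ R)
    (c : Finset ι) (hc : c.card = m) (hcA : ↑c ⊆ A) (k : ℕ) :
    ∀ s : Finset ι, (s \ c).card = k → s.card = m → ↑s ⊆ A →
      |finsetDivDiff s v φ - finsetDivDiff c v φ| ≤ k * (R * M) := by
  induction k with
  | zero =>
    intro s hk hs _
    rw [Finset.card_eq_zero, Finset.sdiff_eq_empty_iff_subset] at hk
    rw [Finset.eq_of_subset_of_card_le hk (by omega)]
    simp
  | succ k ih =>
    intro s hk hs hsA
    obtain ⟨x, hx⟩ : (s \ c).Nonempty := Finset.card_pos.1 (by omega)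
    obtain ⟨y, hy⟩ : (c \ s).Nonempty := Finset.card_pos.1 (by
      rw [Finset.card_sdiff_comm (hc.trans hs.symm)]; omega)
    obtain ⟨e1, e2, e3, e4⟩ := card_and_sdiff_exchange hx hy
    have hxs := (Finset.mem_sdiff.1 hx).1
    have hyc := (Finset.mem_sdiff.1 hy).1
    have hys := (Finset.mem_sdiff.1 hy).2
    have h1 := ih (insert y (s.erase x)) (by rw [e2]; omega) (by omega)
      (by
        intro z hz
        rcases Finset.mem_insert.1 (Finset.mem_coe.1 hz) with rfl | hz
        · exact hcA hyc
        · exact hsA (Finset.mem_of_mem_erase hz))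
    have h2 := finsetDivDiff_sub_exchange hv φ hxs hys
    have h3 := hA (insert y s) (by rw [Finset.card_insert_of_notMem hys, hs]) (by
      rw [Finset.coe_insert]
      exact Set.insert_subset (hcA hyc) hsA)
    have h4 : |(v x - v y) * finsetDivDiff (insert y s) v φ| ≤ R * M := by
      rw [abs_mul]
      have := hR x (hsA hxs) y (hcA hyc)
      exact mul_le_mul this h3 (abs_nonneg _) ((abs_nonneg _).trans this)
    rw [← h2] at h4
    have h5 := abs_sub_le (finsetDivDiff s v φ) (finsetDivDiff (insert y (s.erase x)) v φ)
      (finsetDivDiff c v φ)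
    push_cast
    linarith

/-- Nonnegativity of the divided differences on consecutive nodes implies nonnegativity on all
nodes. -/
theorem finsetDivDiff_nonneg_of_consecutive {v : ℤ → ℝ} (hv : StrictMono v) (φ : ℤ → ℝ) (m : ℕ)
    (d : ℕ) : ∀ a : ℤ,
      (∀ k : ℤ, a ≤ k → k + m ≤ a + d → 0 ≤ finsetDivDiff (Finset.Icc k (k + m)) v φ) →
      ∀ s : Finset ℤ, s.card = m + 1 → s ⊆ Finset.Icc a (a + d) → 0 ≤ finsetDivDiff s v φ := by
  induction d with
  | zero =>
    intro a hcon s hs hsub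
    have hcard := Finset.card_le_card hsub
    simp only [Int.card_Icc] at hcard
    obtain rfl : m = 0 := by omega
    rw [Finset.eq_of_subset_of_card_le hsub (by rw [Int.card_Icc]; omega)]
    exact hcon a le_rfl le_rfl
  | succ d ih =>
    intro a hcon s hs hsub
    have hbot : ∀ t : Finset ℤ, t.card = m + 1 → t ⊆ Finset.Icc a (a + d) →
        0 ≤ finsetDivDiff t v φ := ih a fun k h1 h2 => hcon k h1 (by push_cast; omega)
    have htop : ∀ t : Finset ℤ, t.card = m + 1 → t ⊆ Finset.Icc (a + 1) (a + 1 + d) →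
        0 ≤ finsetDivDiff t v φ :=
      ih (a + 1) fun k h1 h2 => hcon k (by omega) (by push_cast; omega)
    have hmem : ∀ x ∈ s, a ≤ x ∧ x ≤ a + d + 1 := fun x hx => by
      have := Finset.mem_Icc.1 (hsub hx)
      push_cast at this
      omega
    by_cases ha : a ∈ s
    swap
    · refine htop s hs fun x hx => ?_
      have := hmem x hx
      have : x ≠ a := fun h => ha (h ▸ hx)
      rw [Finset.mem_Icc]
      omega
    by_cases hb : a + d + 1 ∈ s
    swap
    · refine hbot s hs fun x hx => ?_
      have := hmem x hx
      have : x ≠ a + d + 1 := fun h => hb (h ▸ hx)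
      rw [Finset.mem_Icc]
      omega
    by_cases hfull : Finset.Icc a (a + d + 1) ⊆ s
    · have heq : s = Finset.Icc a (a + d + 1) := by
        refine Finset.Subset.antisymm (fun x hx => ?_) hfull
        rw [Finset.mem_Icc]
        exact hmem x hx
      have hcard := hs
      rw [heq, Int.card_Icc] at hcard
      have hm : (m : ℤ) = d + 1 := by omega
      have := hcon a le_rfl (by push_cast; omega)
      rwa [heq, add_assoc, ← hm]
    obtain ⟨c, hc, hcs⟩ := Finset.not_subset.1 hfull
    rw [Finset.mem_Icc] at hc
    have hca : c ≠ a := fun h => hcs (h ▸ ha)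
    have hcb : c ≠ a + d + 1 := fun h => hcs (h ▸ hb)
    set b : ℤ := a + d + 1 with hbdef
    have hab : a ≠ b := by omega
    set t := (s.erase a).erase b with ht
    have hts : ∀ x ∈ t, x ∈ s ∧ x ≠ a ∧ x ≠ b := fun x hx => by
      simp only [ht, Finset.mem_erase] at hx
      tauto
    have hat : a ∉ t := fun h => (hts a h).2.1 rfl
    have hbt : b ∉ t := fun h => (hts b h).2.2 rfl
    have hct : c ∉ t := fun h => hcs (hts c h).1
    have hbe : b ∈ s.erase a := Finset.mem_erase.2 ⟨hab.symm, hb⟩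
    have hst : s = insert a (insert b t) := by
      rw [ht, Finset.insert_erase hbe, Finset.insert_erase ha]
    have htc : t.card + 2 = m + 1 := by
      have h1 : t.card + 1 = _ := Finset.card_erase_add_one hbe
      have h2 := Finset.card_erase_add_one ha
      omega
    have h1 := finsetDivDiff_insert_insert hv.injective φ hab hat hbt
    have h2 := finsetDivDiff_insert_insert hv.injective φ hca hct hat
    have h3 := finsetDivDiff_insert_insert hv.injective φ hcb hct hbt
    have h4 : 0 ≤ finsetDivDiff (insert c (insert a t)) v φ := by
      refine hbot _ ?_ ?_
      · rw [Finset.card_insert_of_notMem (by simp [hca, hct]), Finset.card_insert_of_notMem hat]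
        omega
      · intro x hx
        simp only [Finset.mem_insert] at hx
        rw [Finset.mem_Icc]
        rcases hx with rfl | rfl | hx
        · omega
        · omega
        · have := hts x hx
          have := hmem x this.1
          omega
    have h5 : 0 ≤ finsetDivDiff (insert c (insert b t)) v φ := by
      refine htop _ ?_ ?_
      · rw [Finset.card_insert_of_notMem (by simp [hcb, hct]), Finset.card_insert_of_notMem hbt]
        omega
      · intro x hx
        simp only [Finset.mem_insert] at hx
        rw [Finset.mem_Icc]
        rcases hx with rfl | rfl | hx
        · omega
        · omega
        · have := hts x hx
          have := hmem x this.1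
          omega
    rw [← hst] at h1
    have hvac : v a < v c := hv (by omega)
    have hvcb : v c < v b := hv (by omega)
    have h6 := mul_nonneg (sub_pos.2 hvac).le h4
    have h7 := mul_nonneg (sub_pos.2 hvcb).le h5
    have h8 : 0 ≤ (v b - v a) * finsetDivDiff s v φ := by nlinarith
    exact nonneg_of_mul_nonneg_right h8 (sub_pos.2 (hvac.trans hvcb))

end FinsetDivDiff

/-- Divided differences at equidistant nodes are scaled iterated differences. -/
theorem finsetDivDiff_Icc_mul (f : ℝ → ℝ) {δ : ℝ} (hδ : 0 < δ) (m : ℕ) : ∀ k : ℤ,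
    finsetDivDiff (Finset.Icc k (k + m)) (fun i : ℤ => (i : ℝ) * δ) (fun i => f (i * δ)) *
      (m.factorial * δ ^ m) = (dOp δ)^[m] f (k * δ) := by
  have hv : Function.Injective fun i : ℤ => (i : ℝ) * δ := fun i j hij =>
    Int.cast_injective (mul_right_cancel₀ hδ.ne' hij)
  induction m with
  | zero => intro k; simp [finsetDivDiff_singleton]
  | succ m ih =>
    intro k
    have e1 : Finset.Icc k (k + (m + 1 : ℕ)) =
        insert (k + m + 1) (insert k (Finset.Icc (k + 1) (k + m))) := by
      ext x; simp only [Finset.mem_insert, Finset.mem_Icc]; push_cast; omega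
    have e2 : insert (k + m + 1) (Finset.Icc (k + 1) (k + m)) =
        Finset.Icc (k + 1) (k + 1 + m) := by
      ext x; simp only [Finset.mem_insert, Finset.mem_Icc]; omega
    have e3 : insert k (Finset.Icc (k + 1) (k + m)) = Finset.Icc k (k + m) := by
      ext x; simp only [Finset.mem_insert, Finset.mem_Icc]; omega
    have h := finsetDivDiff_insert_insert hv (fun i => f (i * δ)) (a := k + m + 1) (b := k)
      (t := Finset.Icc (k + 1) (k + m)) (by omega) (by simp) (by simp)
    rw [← e1, e2, e3] at h
    have h1 := ih (k + 1)
    have h2 := ih k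
    rw [Function.iterate_succ_apply', dOp]
    have e4 : (k : ℝ) * δ + δ = ((k + 1 : ℤ) : ℝ) * δ := by push_cast; ring
    rw [e4, ← h1, ← h2, ← sub_mul, ← h, Nat.factorial_succ]
    push_cast
    ring

/-- A Jensen convex function has nonnegative divided differences at rational nodes. -/
theorem JensenConvexOrder.finsetDivDiff_nonneg {n : ℕ} {J : Set ℝ} {φ : ℝ → ℝ}
    (h : JensenConvexOrder n J φ) (hJ : J.OrdConnected) (S : Finset ℚ) (hS : S.card = n + 2)
    (hSJ : ∀ q ∈ S, (q : ℝ) ∈ J) :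
    0 ≤ finsetDivDiff S (fun q => (q : ℝ)) (fun q => φ q) := by
  set N : ℕ := ∏ q ∈ S, q.den with hN
  have hNpos : 0 < N := Finset.prod_pos fun q _ => q.den_pos
  have hN0 : (N : ℚ) ≠ 0 := by exact_mod_cast hNpos.ne'
  set δ : ℝ := (N : ℝ)⁻¹ with hδdef
  have hδ : 0 < δ := by positivity
  let e : ℤ ↪ ℚ := ⟨fun m => (m : ℚ) / N, fun a b hab => by
    have := (div_left_inj' hN0).1 hab
    exact_mod_cast this⟩
  have hex : ∀ q ∈ S, ∃ m : ℤ, e m = q := fun q hq => by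
    obtain ⟨c, hc⟩ : q.den ∣ N := Finset.dvd_prod_of_mem _ hq
    refine ⟨q.num * c, ?_⟩
    change ((q.num * c : ℤ) : ℚ) / N = q
    rw [div_eq_iff hN0, hc]
    push_cast
    rw [← mul_assoc, Rat.mul_den_eq_num]
  set T : Finset ℤ := S.preimage e e.injective.injOn with hT
  have hTS : S = T.map e := by
    ext q
    simp only [hT, Finset.mem_map, Finset.mem_preimage]
    constructor
    · intro hq
      obtain ⟨m, rfl⟩ := hex q hq
      exact ⟨m, hq, rfl⟩
    · rintro ⟨m, hm, rfl⟩
      exact hm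
  have hTc : T.card = n + 2 := by rw [← hS, hTS, Finset.card_map]
  have he : ∀ m : ℤ, ((e m : ℚ) : ℝ) = m * δ := fun m => by
    change (((m : ℚ) / N : ℚ) : ℝ) = m * δ
    push_cast
    rw [hδdef, div_eq_mul_inv]
  have hTJ : ∀ m ∈ T, (m : ℝ) * δ ∈ J := fun m hm => by
    rw [← he]
    exact hSJ _ (Finset.mem_preimage.1 hm)
  have hTne : T.Nonempty := Finset.card_pos.1 (by omega)
  have hmin := hTJ _ (T.min'_mem hTne)
  have hmax := hTJ _ (T.max'_mem hTne)
  have hle := T.min'_le _ (T.max'_mem hTne)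
  rw [hTS, finsetDivDiff_map]
  have e1 : (fun q : ℚ => (q : ℝ)) ∘ e = fun m : ℤ => (m : ℝ) * δ := funext he
  have e2 : (fun q : ℚ => φ q) ∘ e = fun m : ℤ => φ (m * δ) := funext fun m => congrArg φ (he m)
  rw [e1, e2]
  refine finsetDivDiff_nonneg_of_consecutive (m := n + 1) (fun a b hab =>
    mul_lt_mul_of_pos_right (by exact_mod_cast hab) hδ) _
    (T.max' hTne - T.min' hTne).toNat (T.min' hTne) ?_ T hTc ?_
  · intro k h1 h2
    have h3 := finsetDivDiff_Icc_mul φ hδ (n + 1) k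
    have hmem : ∀ j : ℤ, T.min' hTne ≤ j → j ≤ T.max' hTne → (j : ℝ) * δ ∈ J :=
      fun j h1 h2 => hJ.out hmin hmax
        ⟨mul_le_mul_of_nonneg_right (by exact_mod_cast h1) hδ.le,
          mul_le_mul_of_nonneg_right (by exact_mod_cast h2) hδ.le⟩
    have h4 := h δ hδ (k * δ) (hmem k h1 (by omega)) (by
      have := hmem (k + (n + 1 : ℕ)) (by omega) (by omega)
      push_cast at this
      convert this using 1
      ring)
    rw [← h3] at h4
    exact nonneg_of_mul_nonneg_left h4 (by positivity)
  · intro x hx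
    have h1 := T.min'_le x hx
    have h2 := T.le_max' x hx
    rw [Finset.mem_Icc]
    omega

section LocalBounds

variable {I : Set ℝ} {f : ℝ → ℝ} {n : ℕ}

theorem exists_rat_nodes_left (hI : IsOpen I) {a : ℚ} (ha : (a : ℝ) ∈ I)
    (hc : I.OrdConnected) (m : ℕ) :
    ∃ C : Finset ℚ, C.card = m ∧ ∀ q ∈ C, (q : ℝ) ∈ I ∧ q < a := by
  obtain ⟨ε, hε, hball⟩ := Metric.isOpen_iff.1 hI _ ha
  obtain ⟨c, hc1, hc2⟩ := exists_rat_btwn (sub_lt_self (a : ℝ) hε)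
  have hcI : (c : ℝ) ∈ I := hball (by
    rw [Metric.mem_ball, Real.dist_eq, abs_lt]; constructor <;> linarith)
  obtain ⟨C, hC, hcard⟩ := (Set.Ioo_infinite (a := c) (b := a)
    (by exact_mod_cast hc2)).exists_subset_card_eq m
  refine ⟨C, hcard, fun q hq => ?_⟩
  have := hC hq
  exact ⟨hc.out hcI ha ⟨by exact_mod_cast this.1.le, by exact_mod_cast this.2.le⟩, this.2⟩

theorem exists_rat_nodes_right (hI : IsOpen I) {a : ℚ} (ha : (a : ℝ) ∈ I)
    (hc : I.OrdConnected) (m : ℕ) :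
    ∃ C : Finset ℚ, C.card = m ∧ ∀ q ∈ C, (q : ℝ) ∈ I ∧ a < q := by
  obtain ⟨ε, hε, hball⟩ := Metric.isOpen_iff.1 hI _ ha
  obtain ⟨c, hc1, hc2⟩ := exists_rat_btwn (lt_add_of_pos_right (a : ℝ) hε)
  have hcI : (c : ℝ) ∈ I := hball (by
    rw [Metric.mem_ball, Real.dist_eq, abs_lt]; constructor <;> linarith)
  obtain ⟨C, hC, hcard⟩ := (Set.Ioo_infinite (a := a) (b := c)
    (by exact_mod_cast hc1)).exists_subset_card_eq m
  refine ⟨C, hcard, fun q hq => ?_⟩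
  have := hC hq
  exact ⟨hc.out ha hcI ⟨by exact_mod_cast this.1.le, by exact_mod_cast this.2.le⟩, this.1⟩

/-- Divided differences of order `n` at rational nodes are locally bounded if those of order
`n + 1` are nonnegative. -/
theorem exists_bound_finsetDivDiff_of_nonneg (hI : IsOpen I) (hc : I.OrdConnected)
    (hf : ∀ S : Finset ℚ, S.card = n + 2 → (∀ q ∈ S, (q : ℝ) ∈ I) →
      0 ≤ finsetDivDiff S (fun q => (q : ℝ)) (fun q => f q))
    {a b : ℚ} (ha : (a : ℝ) ∈ I) (hb : (b : ℝ) ∈ I) :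
    ∃ M : ℝ, ∀ S : Finset ℚ, S.card = n + 1 → ↑S ⊆ Set.Icc a b →
      |finsetDivDiff S (fun q => (q : ℝ)) (fun q => f q)| ≤ M := by
  obtain ⟨C, hC, hCI⟩ := exists_rat_nodes_left hI ha hc (n + 1)
  obtain ⟨D, hD, hDI⟩ := exists_rat_nodes_right hI hb hc (n + 1)
  have hv : Function.Injective fun q : ℚ => (q : ℝ) := Rat.cast_injective
  set A : Set ℚ := {q | (q : ℝ) ∈ I}
  have hA : ∀ s : Finset ℚ, s.card = n + 1 + 1 → ↑s ⊆ A →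
      0 ≤ finsetDivDiff s (fun q => (q : ℝ)) (fun q => f q) := fun s hs hsA =>
    hf s hs fun q hq => hsA hq
  set lo := finsetDivDiff C (fun q => (q : ℝ)) (fun q => f q)
  set hi := finsetDivDiff D (fun q => (q : ℝ)) (fun q => f q)
  refine ⟨max |lo| |hi|, fun S hS hSab => ?_⟩
  have hSA : ↑S ⊆ A := fun q hq => hc.out ha hb
    ⟨by exact_mod_cast (hSab hq).1, by exact_mod_cast (hSab hq).2⟩
  have h1 := finsetDivDiff_le_of_nonneg hv (fun q => f q) hA S hS hSA _ C rfl hC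
    (fun q hq => (hCI q hq).1) fun x hx y hy => by
      have hx := (hCI x (Finset.mem_sdiff.1 hx).1).2
      have hy := (hSab (Finset.mem_sdiff.1 hy).1).1
      exact_mod_cast hx.le.trans hy
  have h2 := finsetDivDiff_le_of_nonneg hv (fun q => f q) hA D hD
    (fun q hq => (hDI q hq).1) _ S rfl hS hSA fun x hx y hy => by
      have hx := (hSab (Finset.mem_sdiff.1 hx).1).2
      have hy := (hDI y (Finset.mem_sdiff.1 hy).1).2
      exact_mod_cast hx.trans hy.le
  exact abs_le_max_abs_abs h1 h2

/-- A bound for divided differences of order `k + 1` gives one for those of order `k`. -/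
theorem exists_bound_finsetDivDiff_pred {v φ : ℚ → ℝ} (hv : Function.Injective v) {k : ℕ} {a b : ℚ}
    (hab : a < b) {R : ℝ} (hR : ∀ x ∈ Set.Icc a b, ∀ y ∈ Set.Icc a b, |v x - v y| ≤ R)
    (h : ∃ M : ℝ, ∀ S : Finset ℚ, S.card = k + 2 → ↑S ⊆ Set.Icc a b →
      |finsetDivDiff S v φ| ≤ M) :
    ∃ M : ℝ, ∀ S : Finset ℚ, S.card = k + 1 → ↑S ⊆ Set.Icc a b →
      |finsetDivDiff S v φ| ≤ M := by
  obtain ⟨M, hM⟩ := h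
  obtain ⟨C, hC, hcard⟩ := (Set.Icc_infinite hab).exists_subset_card_eq (k + 1)
  have hR0 : 0 ≤ R := (abs_nonneg _).trans (hR a ⟨le_rfl, hab.le⟩ a ⟨le_rfl, hab.le⟩)
  have hM0 : 0 ≤ M := by
    obtain ⟨D, hD, hDcard⟩ := (Set.Icc_infinite hab).exists_subset_card_eq (k + 2)
    exact (abs_nonneg _).trans (hM D hDcard hD)
  refine ⟨(k + 1 : ℕ) * (R * M) + |finsetDivDiff C v φ|, fun S hS hSab => ?_⟩
  have h1 := abs_finsetDivDiff_sub_le hv φ hM hR C hcard hC _ S rfl hS hSab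
  have h2 : (S \ C).card ≤ k + 1 := hS ▸ Finset.card_le_card Finset.sdiff_subset
  have h3 : ((S \ C).card : ℝ) * (R * M) ≤ (k + 1 : ℕ) * (R * M) :=
    mul_le_mul_of_nonneg_right (by exact_mod_cast h2) (mul_nonneg hR0 hM0)
  have h4 := abs_sub_abs_le_abs_sub (finsetDivDiff S v φ) (finsetDivDiff C v φ)
  linarith

/-- A function with nonnegative divided differences of order `n + 1 ≥ 2` at rational nodes is
locally Lipschitz on the rationals. -/
theorem exists_lipschitzOnWith_rat (hn : 1 ≤ n) (hI : IsOpen I) (hc : I.OrdConnected)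
    (hf : ∀ S : Finset ℚ, S.card = n + 2 → (∀ q ∈ S, (q : ℝ) ∈ I) →
      0 ≤ finsetDivDiff S (fun q => (q : ℝ)) (fun q => f q))
    {a b : ℚ} (hab : a < b) (ha : (a : ℝ) ∈ I) (hb : (b : ℝ) ∈ I) :
    ∃ K, LipschitzOnWith K f (Set.range ((↑) : ℚ → ℝ) ∩ Set.Icc (a : ℝ) b) := by
  have hv : Function.Injective fun q : ℚ => (q : ℝ) := Rat.cast_injective
  have hR : ∀ x ∈ Set.Icc a b, ∀ y ∈ Set.Icc a b, |(x : ℝ) - y| ≤ (b : ℝ) - a := by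
    intro x hx y hy
    have h1 : (a : ℝ) ≤ x := by exact_mod_cast hx.1
    have h2 : (x : ℝ) ≤ b := by exact_mod_cast hx.2
    have h3 : (a : ℝ) ≤ y := by exact_mod_cast hy.1
    have h4 : (y : ℝ) ≤ b := by exact_mod_cast hy.2
    rw [abs_le]
    constructor <;> linarith
  have key : ∀ j k : ℕ, k + j = n → ∃ M : ℝ, ∀ S : Finset ℚ, S.card = k + 1 →
      ↑S ⊆ Set.Icc a b → |finsetDivDiff S (fun q => (q : ℝ)) (fun q => f q)| ≤ M := by
    intro j
    induction j with
    | zero =>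
      rintro k rfl
      exact exists_bound_finsetDivDiff_of_nonneg hI hc hf ha hb
    | succ j ih =>
      intro k hk
      exact exists_bound_finsetDivDiff_pred hv hab hR (ih (k + 1) (by omega))
  obtain ⟨M, hM⟩ := key (n - 1) 1 (by omega)
  refine ⟨M.toNNReal, LipschitzOnWith.of_dist_le_mul ?_⟩
  rintro _ ⟨⟨x, rfl⟩, hx⟩ _ ⟨⟨y, rfl⟩, hy⟩
  rcases eq_or_ne x y with rfl | hxy
  · simp
  have hx' : x ∈ Set.Icc a b := ⟨by exact_mod_cast hx.1, by exact_mod_cast hx.2⟩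
  have hy' : y ∈ Set.Icc a b := ⟨by exact_mod_cast hy.1, by exact_mod_cast hy.2⟩
  have h1 := hM {x, y} (Finset.card_pair hxy) (by
    intro z hz
    simp only [Finset.coe_insert, Finset.coe_singleton, Set.mem_insert_iff,
      Set.mem_singleton_iff] at hz
    rcases hz with rfl | rfl <;> assumption)
  have h2 := finsetDivDiff_insert_insert hv (fun q => f q) hxy (Finset.notMem_empty x)
    (Finset.notMem_empty y)
  simp only [insert_empty_eq, finsetDivDiff_singleton] at h2
  rw [Real.dist_eq, Real.dist_eq, ← h2, abs_mul, mul_comm]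
  exact mul_le_mul_of_nonneg_right (h1.trans (Real.le_coe_toNNReal M)) (abs_nonneg _)

/-- A function which is locally Lipschitz on the rational points of an open interval agrees at these
points with a function continuous on the interval. -/
theorem exists_continuousOn_eq_rat (hI : IsOpen I)
    (hf : ∀ a b : ℚ, a < b → (a : ℝ) ∈ I → (b : ℝ) ∈ I →
      ∃ K, LipschitzOnWith K f (Set.range ((↑) : ℚ → ℝ) ∩ Set.Icc (a : ℝ) b)) :
    ∃ g : ℝ → ℝ, ContinuousOn g I ∧ ∀ q : ℚ, (q : ℝ) ∈ I → g q = f q := by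
  set A : Set ℝ := Set.range ((↑) : ℚ → ℝ) with hA
  have hcl : ∀ x, x ∈ closure A := Rat.denseRange_cast
  have key : ∀ x ∈ I, ∃ y, Filter.Tendsto f (nhdsWithin x A) (nhds y) ∧ (x ∈ A → y = f x) := by
    intro x hx
    obtain ⟨ε, hε, hball⟩ := Metric.isOpen_iff.1 hI _ hx
    obtain ⟨a, ha1, ha2⟩ := exists_rat_btwn (sub_lt_self x hε)
    obtain ⟨b, hb1, hb2⟩ := exists_rat_btwn (lt_add_of_pos_right x hε)
    obtain ⟨K, hK⟩ := hf a b (by exact_mod_cast ha2.trans hb1)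
      (hball (by rw [Metric.mem_ball, Real.dist_eq, abs_lt]; constructor <;> linarith))
      (hball (by rw [Metric.mem_ball, Real.dist_eq, abs_lt]; constructor <;> linarith))
    obtain ⟨g, hg, hgf⟩ := hK.extend_real
    refine ⟨g x, ?_, fun hxA => (hgf ⟨hxA, ha2.le, hb1.le⟩).symm⟩
    refine (hg.continuous.continuousAt.tendsto.mono_left nhdsWithin_le_nhds).congr' ?_
    filter_upwards [self_mem_nhdsWithin, nhdsWithin_le_nhds (Icc_mem_nhds ha2 hb1)] with z hz1 hz2
    exact (hgf ⟨hz1, hz2⟩).symm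
  refine ⟨extendFrom A f, continuousOn_extendFrom (fun x _ => hcl x) fun x hx => ?_, ?_⟩
  · obtain ⟨y, hy, _⟩ := key x hx
    exact ⟨y, hy⟩
  · intro q hq
    obtain ⟨y, hy, hyq⟩ := key q hq
    rw [extendFrom_eq (hcl _) hy, hyq ⟨q, rfl⟩]

end LocalBounds

/-- A continuous function with nonnegative divided differences at rational nodes is convex of
higher order. -/
theorem convexOrder_of_rat {n : ℕ} {I : Set ℝ} (hI : IsOpen I) {g : ℝ → ℝ}
    (hg : ContinuousOn g I)
    (h : ∀ S : Finset ℚ, S.card = n + 2 → (∀ q ∈ S, (q : ℝ) ∈ I) →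
      0 ≤ finsetDivDiff S (fun q => (q : ℝ)) (fun q => g q)) :
    ConvexOrder n I g := by
  intro x hx hxI
  by_contra hneg
  rw [not_le] at hneg
  have hcont : ContinuousAt (fun y : Fin (n + 2) → ℝ => divDiff (n + 1) y g) x := by
    unfold divDiff
    refine tendsto_finsetSum _ fun i _ => ?_
    refine ContinuousAt.div ?_ ?_ ?_
    · exact (hg.continuousAt (hI.mem_nhds (hxI i))).comp_of_eq (continuous_apply i).continuousAt rfl
    · fun_prop
    · exact Finset.prod_ne_zero_iff.2 fun j hj =>
        sub_ne_zero.2 (hx.ne (Finset.ne_of_mem_erase hj).symm)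
  have h1 : ∀ᶠ y in nhds x, divDiff (n + 1) y g < 0 := hcont.eventually_lt_const hneg
  have h2 : ∀ᶠ y in nhds x, ∀ i : Fin (n + 2), y i ∈ I := by
    rw [Filter.eventually_all]
    exact fun i => (continuous_apply i).continuousAt.eventually (hI.mem_nhds (hxI i))
  have h3 : ∀ᶠ y in nhds x, ∀ i j : Fin (n + 2), i ≠ j → y i ≠ y j := by
    simp only [Filter.eventually_all]
    exact fun i j hij =>
      (isOpen_ne_fun (continuous_apply i) (continuous_apply j)).mem_nhds (hx.ne hij)
  have hdense : DenseRange (Pi.map fun (_ : Fin (n + 2)) (q : ℚ) => (q : ℝ)) :=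
    DenseRange.piMap fun _ => Rat.denseRange_cast
  obtain ⟨y, ⟨hy1, hy2, hy3⟩, q, rfl⟩ :=
    mem_closure_iff_nhds.1 (hdense x) _ (h1.and (h2.and h3))
  have hq : Function.Injective q := fun i j hij => by
    by_contra hne
    exact hy3 i j hne (congrArg (fun r : ℚ => (r : ℝ)) hij)
  have h4 := h (Finset.univ.map ⟨q, hq⟩) (by simp) (by
    intro r hr
    obtain ⟨i, _, rfl⟩ := Finset.mem_map.1 hr
    exact hy2 i)
  rw [finsetDivDiff_map] at h4
  exact absurd h4 (not_le.2 hy1)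

theorem dOp_leftComm (h k : ℝ) (f : ℝ → ℝ) : dOp h (dOp k f) = dOp k (dOp h f) := by
  funext x
  simp only [dOp]
  rw [add_right_comm]
  ring

theorem dList_cons (h : ℝ) (l : List ℝ) (f : ℝ → ℝ) (x : ℝ) :
    dList (h :: l) f x = dList l f (x + h) - dList l f x := rfl

theorem dList_perm {l l' : List ℝ} (h : l.Perm l') (f : ℝ → ℝ) : dList l f = dList l' f :=
  h.foldr_eq' (fun x _ y _ z => dOp_leftComm y x z) f

theorem dList_sub (l : List ℝ) (f g : ℝ → ℝ) (x : ℝ) :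
    dList l (fun t => f t - g t) x = dList l f x - dList l g x := by
  induction l generalizing x with
  | nil => rfl
  | cons h l ih =>
    simp only [dList_cons, ih]
    ring

theorem dList_replicate (m : ℕ) (h : ℝ) (f : ℝ → ℝ) :
    dList (List.replicate m h) f = (dOp h)^[m] f := by
  induction m with
  | zero => rfl
  | succ m ih =>
    rw [Function.iterate_succ_apply', ← ih]
    rfl

theorem list_sum_nonneg_of_pos {l : List ℝ} (hl : ∀ h ∈ l, 0 < h) : 0 ≤ l.sum :=
  List.sum_nonneg fun h hh => (hl h hh).le

theorem WrightConvexOrder.jensenConvexOrder {n : ℕ} {I : Set ℝ} {f : ℝ → ℝ}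
    (hf : WrightConvexOrder n I f) : JensenConvexOrder n I f := by
  intro h hh x hx hx'
  rw [← dList_replicate]
  refine hf _ (by simp) (fun k hk => (List.eq_of_mem_replicate hk) ▸ hh) x hx ?_
  simpa using hx'

/-- The set of points where the differences with steps `l` only involve points of `I`. -/
def dListDomain (I : Set ℝ) (l : List ℝ) : Set ℝ := {x | x ∈ I ∧ x + l.sum ∈ I}

theorem dListDomain_cons {I : Set ℝ} (hI : I.OrdConnected) {h : ℝ} {l : List ℝ} (hh : 0 < h)
    (hl : ∀ k ∈ l, 0 < k) {x : ℝ} (hx : x ∈ dListDomain I (h :: l)) :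
    x + h ∈ dListDomain I l ∧ x ∈ dListDomain I l := by
  have hs := list_sum_nonneg_of_pos hl
  obtain ⟨h1, h2⟩ := hx
  rw [List.sum_cons] at h2
  refine ⟨⟨hI.out h1 h2 ⟨by linarith, by linarith⟩, by rwa [add_assoc]⟩, h1,
    hI.out h1 h2 ⟨by linarith, by linarith⟩⟩

theorem isOpen_dListDomain {I : Set ℝ} (hI : IsOpen I) (l : List ℝ) :
    IsOpen (dListDomain I l) :=
  hI.inter (hI.preimage (continuous_add_const _))

theorem continuousOn_dList {I : Set ℝ} (hI : I.OrdConnected) {g : ℝ → ℝ} (hg : ContinuousOn g I)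
    (l : List ℝ) (hl : ∀ h ∈ l, 0 < h) : ContinuousOn (dList l g) (dListDomain I l) := by
  induction l with
  | nil => exact hg.mono fun x hx => hx.1
  | cons h l ih =>
    rw [List.forall_mem_cons] at hl
    have := ih hl.2
    exact ContinuousOn.sub
      (this.comp (by fun_prop) fun x hx => (dListDomain_cons hI hl.1 hl.2 hx).1)
      (this.mono fun x hx => (dListDomain_cons hI hl.1 hl.2 hx).2)

theorem WrightConvexOrder.monotoneOn_dList {n : ℕ} {I : Set ℝ} {f : ℝ → ℝ}
    (hf : WrightConvexOrder n I f) {l : List ℝ} (hln : l.length = n) (hl : ∀ h ∈ l, 0 < h) :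
    MonotoneOn (dList l f) (dListDomain I l) := by
  intro x hx y hy hxy
  rcases hxy.eq_or_lt with rfl | hlt
  · rfl
  have := hf ((y - x) :: l) (by simp [hln])
    (List.forall_mem_cons.2 ⟨sub_pos.2 hlt, hl⟩) x hx.1 (by
      rw [List.sum_cons, ← add_assoc, add_sub_cancel]
      exact hy.2)
  rw [dList_cons, add_sub_cancel] at this
  linarith

/-- If a function becomes monotone after adding a continuous one and takes a value on a dense set,
then it takes this value everywhere. -/
theorem eq_of_monotoneOn_add {D : Set ℝ} (hD : IsOpen D) {u c : ℝ → ℝ} (hc : ContinuousOn c D)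
    (hm : MonotoneOn (fun x => u x + c x) D) {v : ℝ}
    (hv : ∀ a b : ℝ, a < b → Set.Ioo a b ⊆ D → ∃ z ∈ Set.Ioo a b, u z = v) {y : ℝ} (hy : y ∈ D) :
    u y = v := by
  refine eq_of_forall_dist_le fun ε hε => ?_
  obtain ⟨δ, hδ, hδc⟩ := Metric.continuousAt_iff.1 (hc.continuousAt (hD.mem_nhds hy)) ε hε
  obtain ⟨η, hη, hball⟩ := Metric.isOpen_iff.1 hD y hy
  set ρ := min δ η
  have hρ : 0 < ρ := lt_min hδ hη
  have hsub : ∀ z, |z - y| < ρ → z ∈ D ∧ |c z - c y| < ε := fun z hz =>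
    ⟨hball (by rw [Metric.mem_ball, Real.dist_eq]; exact hz.trans_le (min_le_right _ _)), by
      have := hδc (x := z) (by rw [Real.dist_eq]; exact hz.trans_le (min_le_left _ _))
      rwa [Real.dist_eq] at this⟩
  obtain ⟨z, hz, hzv⟩ := hv (y - ρ) y (by linarith) fun z hz =>
    (hsub z (by rw [abs_lt]; constructor <;> linarith [hz.1, hz.2])).1
  obtain ⟨w, hw, hwv⟩ := hv y (y + ρ) (by linarith) fun z hz =>
    (hsub z (by rw [abs_lt]; constructor <;> linarith [hz.1, hz.2])).1
  have hz' := hsub z (by rw [abs_lt]; constructor <;> linarith [hz.1, hz.2])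
  have hw' := hsub w (by rw [abs_lt]; constructor <;> linarith [hw.1, hw.2])
  have h1 := hm hz'.1 hy hz.2.le
  have h2 := hm hy hw'.1 hw.1.le
  have h3 := abs_lt.1 hz'.2
  have h4 := abs_lt.1 hw'.2
  simp only [hzv, hwv] at h1 h2
  rw [Real.dist_eq, abs_le]
  constructor <;> linarith

theorem dList_eq_zero_of_rat {I : Set ℝ} (hI : I.OrdConnected) {p : ℝ → ℝ}
    (hp : ∀ q : ℚ, (q : ℝ) ∈ I → p q = 0) (l : List ℝ) (hl : ∀ h ∈ l, 0 < h)
    (hr : ∀ h ∈ l, IsRatR h) (q : ℚ) (hq : (q : ℝ) ∈ dListDomain I l) : dList l p q = 0 := by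
  induction l generalizing q with
  | nil => exact hp q hq.1
  | cons h l ih =>
    rw [List.forall_mem_cons] at hl hr
    obtain ⟨r, rfl⟩ := hr.1
    have := dListDomain_cons hI hl.1 hl.2 hq
    rw [dList_cons, ih hl.2 hr.2 q this.2, ← Rat.cast_add, ih hl.2 hr.2, sub_zero]
    rw [Rat.cast_add]
    exact this.1

/-- If a Wright convex function agrees with a continuous function at the rational points, then all
differences of length `n` of their difference are constant. -/
theorem WrightConvexOrder.dList_sub_const {n : ℕ} {I : Set ℝ} {f g : ℝ → ℝ} (hIo : IsOpen I)
    (hI : I.OrdConnected) (hf : WrightConvexOrder n I f) (hg : ContinuousOn g I)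
    (hfg : ∀ q : ℚ, (q : ℝ) ∈ I → g q = f q) (hs rs : List ℝ) :
    (hs ++ rs).length = n → (∀ h ∈ hs ++ rs, 0 < h) → (∀ r ∈ rs, IsRatR r) →
      ∀ x ∈ dListDomain I (hs ++ rs), ∀ y ∈ dListDomain I (hs ++ rs),
        dList (hs ++ rs) (fun t => f t - g t) x = dList (hs ++ rs) (fun t => f t - g t) y := by
  induction hs generalizing rs with
  | nil =>
    simp only [List.nil_append]
    intro hn hpos hrat
    have key : ∀ y ∈ dListDomain I rs, dList rs (fun t => f t - g t) y = 0 := fun y hy => by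
      refine eq_of_monotoneOn_add (isOpen_dListDomain hIo rs) (continuousOn_dList hI hg rs hpos)
        ?_ (fun a b hab hsub => ?_) hy
      · refine (hf.monotoneOn_dList hn hpos).congr fun x _ => ?_
        simp only [dList_sub]
        ring
      · obtain ⟨q, hq⟩ := exists_rat_btwn hab
        exact ⟨q, hq, dList_eq_zero_of_rat hI (fun q hq => by rw [hfg q hq, sub_self]) rs hpos hrat
          q (hsub hq)⟩
    intro x hx y hy
    rw [key x hx, key y hy]
  | cons h hs ih =>
    intro hn hpos hrat x hx y hy
    set p : ℝ → ℝ := fun t => f t - g t with hp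
    rw [List.cons_append] at *
    set l := h :: (hs ++ rs) with hl
    have hpos' := List.forall_mem_cons.1 hpos
    have periodic : ∀ r : ℚ, 0 < r → ∀ z ∈ dListDomain I l, z + r ∈ dListDomain I l →
        dList l p (z + r) = dList l p z := by
      intro r hr z hz hzr
      have hr' : (0 : ℝ) < r := by exact_mod_cast hr
      have hperm : ((r : ℝ) :: l).Perm (h :: (hs ++ (rs ++ [(r : ℝ)]))) := by
        rw [← List.append_assoc]
        exact ((List.perm_append_singleton (r : ℝ) l).symm).trans (List.Perm.refl _)
      have hposm : ∀ k ∈ hs ++ (rs ++ [(r : ℝ)]), 0 < k := by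
        intro k hk
        simp only [List.mem_append, List.mem_singleton] at hk
        rcases hk with hk | hk | rfl
        · exact hpos'.2 k (by simp [hk])
        · exact hpos'.2 k (by simp [hk])
        · exact hr'
      have hdom : z ∈ dListDomain I (h :: (hs ++ (rs ++ [(r : ℝ)]))) := by
        refine ⟨hz.1, ?_⟩
        rw [← hperm.sum_eq, List.sum_cons, ← add_assoc]
        exact hzr.2
      have hdom' := dListDomain_cons hI hpos'.1 hposm hdom
      have := ih (rs ++ [(r : ℝ)]) (by
          simp only [hl, List.length_cons, List.length_append] at hn ⊢
          simp only [List.length_nil]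
          omega) hposm (by
          intro k hk
          rcases List.mem_append.1 hk with hk | hk
          · exact hrat k hk
          · rw [List.mem_singleton.1 hk]
            exact ⟨r, rfl⟩) _ hdom'.1 _ hdom'.2
      have h1 := dList_cons r l p z
      rw [dList_perm hperm, dList_cons, this, sub_self] at h1
      linarith
    symm
    refine eq_of_monotoneOn_add (isOpen_dListDomain hIo l) (continuousOn_dList hI hg l hpos)
      ?_ (fun a b hab hsub => ?_) hy
    · refine (hf.monotoneOn_dList hn hpos).congr fun x _ => ?_
      simp only [hp, dList_sub]
      ring
    · obtain ⟨q, hq1, hq2⟩ := exists_rat_btwn (sub_lt_sub_right hab x)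
      have hmem : x + q ∈ Set.Ioo a b := ⟨by linarith, by linarith⟩
      refine ⟨x + q, hmem, ?_⟩
      have hD := hsub hmem
      rcases lt_trichotomy q 0 with h0 | rfl | h0
      · have := periodic (-q) (by linarith) (x + q) hD (by simpa using hx)
        simpa using this.symm
      · simp
      · exact periodic q h0 x hx hD

theorem WrightConvexOrder.dList_sub_eq_zero {n : ℕ} {I : Set ℝ} {f g : ℝ → ℝ} (hIo : IsOpen I)
    (hI : I.OrdConnected) (hf : WrightConvexOrder n I f) (hg : ContinuousOn g I)
    (hfg : ∀ q : ℚ, (q : ℝ) ∈ I → g q = f q) {h : ℝ} {l : List ℝ} (hn : l.length = n)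
    (hh : 0 < h) (hl : ∀ k ∈ l, 0 < k) {x : ℝ} (hx : x ∈ dListDomain I (h :: l)) :
    dList (h :: l) (fun t => f t - g t) x = 0 := by
  have hx' := dListDomain_cons hI hh hl hx
  have := hf.dList_sub_const hIo hI hg hfg l []
  simp only [List.append_nil] at this
  rw [dList_cons, this hn hl (by simp) _ hx'.1 _ hx'.2, sub_self]

theorem dOp_iterate_eq_sum (h : ℝ) (f : ℝ → ℝ) (m : ℕ) (x : ℝ) :
    (dOp h)^[m] f x =
      ∑ k ∈ Finset.range (m + 1), ((-1 : ℤ) ^ (m - k) * m.choose k) • f (x + k • h) :=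
  fwdDiff_iter_eq_sum_shift h f m x

theorem dOp_iterate_congr {h : ℝ} {f g : ℝ → ℝ} {m : ℕ} {x : ℝ}
    (hfg : ∀ k ≤ m, f (x + k * h) = g (x + k * h)) : (dOp h)^[m] f x = (dOp h)^[m] g x := by
  rw [dOp_iterate_eq_sum, dOp_iterate_eq_sum]
  refine Finset.sum_congr rfl fun k hk => ?_
  rw [nsmul_eq_mul, hfg k (Nat.lt_succ_iff.1 (Finset.mem_range.1 hk))]

theorem dOp_iterate_sum_smul {α : Type*} (s : Finset α) (w : α → ℝ) (f : α → ℝ → ℝ) (h : ℝ)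
    (m : ℕ) (x : ℝ) :
    (dOp h)^[m] (∑ i ∈ s, w i • f i) x = ∑ i ∈ s, w i * (dOp h)^[m] (f i) x := by
  have := fwdDiff_iter_finsetSum (h := h) s (fun i => w i • f i) m
  simp only [fwdDiff_iter_const_smul] at this
  exact (congrFun this x).trans (by rw [Finset.sum_apply]; rfl)

theorem dOp_iterate_neg_fun (h : ℝ) (f : ℝ → ℝ) (m : ℕ) (x : ℝ) :
    (dOp h)^[m] (fun t => -f t) x = -(dOp h)^[m] f x := by
  simp [dOp_iterate_eq_sum]

theorem dOp_iterate_comp_affine (a b h : ℝ) (f : ℝ → ℝ) (m : ℕ) (x : ℝ) :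
    (dOp h)^[m] (fun t => f (a + b * t)) x = (dOp (b * h))^[m] f (a + b * x) := by
  simp only [dOp_iterate_eq_sum, nsmul_eq_mul]
  refine Finset.sum_congr rfl fun k _ => ?_
  congr 2
  ring

theorem dOp_neg_iterate (h : ℝ) (f : ℝ → ℝ) (m : ℕ) (x : ℝ) :
    (dOp (-h))^[m] f x = (-1) ^ m * (dOp h)^[m] f (x - m * h) := by
  induction m generalizing x with
  | zero => simp
  | succ m ih =>
    rw [Function.iterate_succ_apply', Function.iterate_succ_apply', dOp, dOp, ih, ih]
    have e1 : x + -h - m * h = x - (m + 1 : ℕ) * h := by push_cast; ring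
    have e2 : x - m * h = x - (m + 1 : ℕ) * h + h := by push_cast; ring
    rw [e1, e2]
    ring

/-- Fréchet's equation on `I` for positive steps implies it for all steps. -/
theorem dOp_iterate_eq_zero_of_pos {n : ℕ} {I : Set ℝ} {p : ℝ → ℝ}
    (hp : ∀ h : ℝ, 0 < h → ∀ x ∈ I, x + (n + 1) * h ∈ I → (dOp h)^[n + 1] p x = 0)
    (h x : ℝ) (hx : x ∈ I) (hxh : x + (n + 1) * h ∈ I) : (dOp h)^[n + 1] p x = 0 := by
  rcases lt_trichotomy h 0 with h0 | rfl | h0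
  · have := dOp_neg_iterate (-h) p (n + 1) x
    rw [neg_neg] at this
    rw [this, hp (-h) (by linarith), mul_zero]
    · convert hxh using 1
      push_cast
      ring
    · convert hx using 1
      push_cast
      ring
  · rw [Function.iterate_succ_apply', dOp, add_zero, sub_self]
  · exact hp h h0 x hx hxh

/-- Solutions of Fréchet's equation are polynomials at rational points. -/
theorem exists_polynomial_eq_of_dOp_eq_zero {n : ℕ} {J : Set ℝ} {ψ : ℝ → ℝ} (hJo : IsOpen J)
    (hJ : J.OrdConnected) (h0 : (0 : ℝ) ∈ J)
    (hψ : ∀ h : ℝ, 0 < h → ∀ x ∈ J, x + (n + 1) * h ∈ J → (dOp h)^[n + 1] ψ x = 0) :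
    ∃ Q : Polynomial ℝ, Q.degree < (n + 1 : ℕ) ∧ ∀ q : ℚ, (q : ℝ) ∈ J → Q.eval (q : ℝ) = ψ q := by
  have hv : Function.Injective fun q : ℚ => (q : ℝ) := Rat.cast_injective
  obtain ⟨C, hC, hCJ⟩ := exists_rat_nodes_right hJo (a := 0) (by simpa using h0) hJ (n + 1)
  set Q := Lagrange.interpolate C (fun q : ℚ => (q : ℝ)) (fun q => ψ q) with hQ
  have hdeg : Q.degree < (n + 1 : ℕ) := hC ▸ Lagrange.degree_interpolate_lt _ hv.injOn
  have hnode : ∀ q ∈ C, Q.eval (q : ℝ) = ψ q := fun q hq =>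
    Lagrange.eval_interpolate_at_node (v := fun q : ℚ => (q : ℝ)) (fun q => ψ q) hv.injOn hq
  refine ⟨Q, hdeg, fun q hq => ?_⟩
  by_cases hqC : q ∈ C
  · exact hnode q hqC
  have hcard : (insert q C).card = n + 2 := by rw [Finset.card_insert_of_notMem hqC, hC]
  have hSJ : ∀ r ∈ insert q C, (r : ℝ) ∈ J := fun r hr => by
    rcases Finset.mem_insert.1 hr with rfl | hr
    · exact hq
    · exact (hCJ r hr).1
  have h1 : 0 ≤ finsetDivDiff (insert q C) (fun q => (q : ℝ)) (fun q => ψ q) :=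
    JensenConvexOrder.finsetDivDiff_nonneg (n := n) (J := J)
      (fun h hh x hx hxh => (hψ h hh x hx hxh).ge) hJ _ hcard hSJ
  have h2 : 0 ≤ finsetDivDiff (insert q C) (fun q => (q : ℝ)) (fun q => -ψ q) :=
    JensenConvexOrder.finsetDivDiff_nonneg (n := n) (J := J) (φ := fun t => -ψ t)
      (fun h hh x hx hxh => by rw [dOp_iterate_neg_fun, hψ h hh x hx hxh, neg_zero]) hJ _ hcard hSJ
  rw [finsetDivDiff_neg] at h2
  have h3 : finsetDivDiff (insert q C) (fun q => (q : ℝ)) (fun q => Q.eval (q : ℝ)) = 0 := by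
    have hlt : Q.degree < (n + 2 : ℕ) := hdeg.trans (by norm_cast; omega)
    have := Lagrange.coeff_eq_sum (s := insert q C) (v := fun q : ℚ => (q : ℝ)) hv.injOn (P := Q)
      (by rw [hcard]; exact hlt)
    rw [hcard, Polynomial.coeff_eq_zero_of_degree_lt (by simpa using hdeg)] at this
    exact this.symm
  have h4 := finsetDivDiff_sub (insert q C) (fun q => (q : ℝ)) (fun q => Q.eval (q : ℝ))
    (fun q => ψ q)
  rw [h3, le_antisymm (by linarith) h1, sub_zero, finsetDivDiff, Finset.sum_insert hqC,
    Finset.sum_eq_zero fun r hr => by rw [hnode r hr, sub_self, zero_div], add_zero,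
    div_eq_zero_iff] at h4
  refine sub_eq_zero.1 (h4.resolve_right (Finset.prod_ne_zero_iff.2 fun r hr => ?_))
  exact sub_ne_zero.2 (hv.ne (Finset.ne_of_mem_erase hr).symm)

/-- A solution of Fréchet's equation on an open interval extends to the real line. -/
theorem exists_extension_of_dOp_eq_zero {n : ℕ} {I : Set ℝ} (hIo : IsOpen I) (hI : I.OrdConnected)
    (hne : I.Nonempty) {p : ℝ → ℝ}
    (hp : ∀ h : ℝ, 0 < h → ∀ x ∈ I, x + (n + 1) * h ∈ I → (dOp h)^[n + 1] p x = 0) :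
    ∃ P : ℝ → ℝ, (∀ h : ℝ, 0 < h → ∀ x : ℝ, (dOp h)^[n + 1] P x = 0) ∧ ∀ x ∈ I, P x = p x := by
  obtain ⟨a, ha⟩ := hne
  have hp' := dOp_iterate_eq_zero_of_pos hp
  have hpoly : ∀ y : ℝ, ∃ Q : Polynomial ℝ, Q.degree < (n + 1 : ℕ) ∧
      ∀ q : ℚ, a + y * q ∈ I → Q.eval (q : ℝ) = p (a + y * q) := by
    intro y
    refine exists_polynomial_eq_of_dOp_eq_zero (J := {t | a + y * t ∈ I})
      (ψ := fun t => p (a + y * t)) (hIo.preimage (by fun_prop)) ⟨?_⟩ (by simpa using ha) ?_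
    · intro s hs u hu t ht
      refine hI.uIcc_subset hs hu (Set.mem_uIcc.2 ?_)
      rcases le_total 0 y with hy | hy
      · left
        constructor <;> nlinarith [mul_le_mul_of_nonneg_left ht.1 hy,
          mul_le_mul_of_nonneg_left ht.2 hy]
      · right
        constructor <;> nlinarith [mul_le_mul_of_nonpos_left ht.1 hy,
          mul_le_mul_of_nonpos_left ht.2 hy]
    · intro h _ x hx hxh
      rw [dOp_iterate_comp_affine]
      refine hp' _ _ hx ?_
      convert (show a + y * (x + (n + 1) * h) ∈ I from hxh) using 1
      ring
  choose Q hQdeg hQ using hpoly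
  refine ⟨fun x => (Q (x - a)).eval 1, fun h hh x => ?_, fun x hx => ?_⟩
  swap
  · have := hQ (x - a) 1 (by simpa using hx)
    simpa using this
  obtain ⟨δ, hδ, hball⟩ := Metric.isOpen_iff.1 hIo a ha
  set R : ℝ := |x - a| + (n + 1) * h with hR
  have hR0 : 0 ≤ R := by positivity
  obtain ⟨N, hN⟩ := exists_nat_gt (n * R / δ)
  have hN0 : (0 : ℝ) < N := lt_of_le_of_lt (by positivity) hN
  have hmem : ∀ i ≤ n, ∀ k ≤ n + 1, a + (x + k * h - a) * (i / N : ℝ) ∈ I := by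
    intro i hi k hk
    refine hball ?_
    have hi' : (i : ℝ) ≤ n := by exact_mod_cast hi
    have hk' : (k : ℝ) ≤ n + 1 := by exact_mod_cast hk
    have h1 : |x + k * h - a| ≤ R := by
      have e : x + k * h - a = (x - a) + k * h := by ring
      rw [e]
      refine (abs_add_le _ _).trans ?_
      rw [abs_of_nonneg (a := k * h) (by positivity)]
      have := mul_le_mul_of_nonneg_right hk' hh.le
      linarith
    rw [Metric.mem_ball, Real.dist_eq, add_sub_cancel_left, abs_mul, abs_div,
      abs_of_pos hN0, abs_of_nonneg (Nat.cast_nonneg (α := ℝ) i), ← mul_div_assoc, div_lt_iff₀ hN0]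
    rw [div_lt_iff₀ hδ] at hN
    calc |x + k * h - a| * i ≤ R * n := mul_le_mul h1 hi' (by positivity) hR0
      _ < δ * N := by linarith
  set v : ℕ → ℝ := fun i => (i / N : ℝ) with hv
  have hvinj : Function.Injective v := fun i j hij => by
    have := (div_left_inj' hN0.ne').1 hij
    exact_mod_cast this
  set w : ℕ → ℝ := fun i => (Lagrange.basis (Finset.range (n + 1)) v i).eval 1 with hw
  have hcongr : ∀ k ≤ n + 1, (Q (x + k * h - a)).eval 1 =
      (∑ i ∈ Finset.range (n + 1), w i • fun z => p ((a - v i * a) + v i * z)) (x + k * h) := by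
    intro k hk
    have hint := Lagrange.eq_interpolate_of_eval_eq (s := Finset.range (n + 1)) (v := v)
      (f := Q (x + k * h - a)) (fun i => p ((a - v i * a) + v i * (x + k * h))) hvinj.injOn
      (by rw [Finset.card_range]; exact hQdeg _) fun i hi => by
        have hi' : i ≤ n := Nat.lt_succ_iff.1 (Finset.mem_range.1 hi)
        have e : ((i / N : ℚ) : ℝ) = v i := by simp [hv]
        have := hQ (x + k * h - a) (i / N : ℚ) (by rw [e]; exact hmem i hi' k hk)
        rw [e] at this
        rw [this]
        congr 1
        ring
    rw [hint, Lagrange.interpolate_apply, Polynomial.eval_finsetSum, Finset.sum_apply]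
    refine Finset.sum_congr rfl fun i _ => ?_
    simp only [Polynomial.eval_mul, Polynomial.eval_C, Pi.smul_apply, smul_eq_mul, hw]
    ring
  rw [dOp_iterate_congr hcongr, dOp_iterate_sum_smul]
  refine Finset.sum_eq_zero fun i hi => ?_
  have hi' : i ≤ n := Nat.lt_succ_iff.1 (Finset.mem_range.1 hi)
  rw [dOp_iterate_comp_affine, hp', mul_zero]
  · have := hmem i hi' 0 (by omega)
    convert this using 1
    simp only [hv]
    push_cast
    ring
  · have := hmem i hi' (n + 1) le_rfl
    convert this using 1
    simp only [hv]
    push_cast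
    ring

/-- Maksa–Pales decomposition: an n-Wright convex function is the sum of an n-convex
function and a polynomial function of degree at most n. -/
theorem wright_convex_decomposition (n : ℕ) (hn : 1 ≤ n) (I : Set ℝ)
    (hI : ProperOpenInterval I) (f : ℝ → ℝ) (hf : WrightConvexOrder n I f) :
    ∃ g P : ℝ → ℝ, ConvexOrder n I g ∧
      (∀ h : ℝ, 0 < h → ∀ x : ℝ, (dOp h)^[n + 1] P x = 0) ∧
      ∀ x ∈ I, f x = g x + P x := by
  obtain ⟨hIo, hc, hne, -⟩ := hI
  have hdd : ∀ S : Finset ℚ, S.card = n + 2 → (∀ q ∈ S, (q : ℝ) ∈ I) →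
      0 ≤ finsetDivDiff S (fun q => (q : ℝ)) (fun q => f q) :=
    hf.jensenConvexOrder.finsetDivDiff_nonneg hc
  obtain ⟨g, hg, hgf⟩ := exists_continuousOn_eq_rat hIo fun a b hab ha hb =>
    exists_lipschitzOnWith_rat hn hIo hc hdd hab ha hb
  obtain ⟨P, hP, hPI⟩ := exists_extension_of_dOp_eq_zero (n := n) hIo hc hne
    (p := fun t => f t - g t) fun h hh x hx hxh => by
      rw [← dList_replicate, List.replicate_succ]
      refine hf.dList_sub_eq_zero hIo hc hg hgf (by simp) hh
        (fun k hk => (List.eq_of_mem_replicate hk) ▸ hh) ⟨hx, ?_⟩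
      rw [← List.replicate_succ]
      simpa using hxh
  refine ⟨g, P, convexOrder_of_rat hIo hg fun S hS hSI => ?_, hP, fun x hx => ?_⟩
  · rw [finsetDivDiff_congr fun q hq => hgf q (hSI q hq)]
    exact hdd S hS hSI
  · rw [hPI x hx]
    ring
end

section
/- Let n ∈ ℕ (n ≥ 1) and let I be a proper open subinterval of ℝ. If f : I → ℝ is Jensen convex of order n, then for every compact subinterval [a,b] ⊆ I there exists a constant K ≥ 0 such that |f(x)| ≤ K for all rational x ∈ [a,b] ∩ ℚ; that is, f is bounded on the rational points of every compact subinterval of I. -/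
open Finset

theorem dOp_eq_fwdDiff : dOp = fwdDiff := rfl

/-- Some increment of a sequence over `[a, b)` is at most the average increment. -/
theorem exists_increment_le (v : ℕ → ℝ) {a b : ℕ} (hab : a < b) :
    ∃ l, a ≤ l ∧ l < b ∧ ((b : ℝ) - a) * (v (l + 1) - v l) ≤ v b - v a := by
  have hpos : (0 : ℝ) < (b : ℝ) - a := sub_pos.2 (by exact_mod_cast hab)
  obtain ⟨l, hl, hle⟩ := Finset.exists_le_of_sum_le (s := Finset.Ico a b)
    (f := fun l => v (l + 1) - v l) (g := fun _ => (v b - v a) / ((b : ℝ) - a))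
    (Finset.nonempty_Ico.2 hab) (by
      rw [Finset.sum_Ico_sub v hab.le, Finset.sum_const, Nat.card_Ico, nsmul_eq_mul,
        Nat.cast_sub hab.le, mul_div_cancel₀ _ hpos.ne'])
  rw [Finset.mem_Ico] at hl
  exact ⟨l, hl.1, hl.2, by rwa [le_div_iff₀' hpos] at hle⟩

/-- A discrete Rolle theorem: if `f` weakly alternates in sign at `m + 1` points of a grid,
is nonpositive at the last one, and is nonzero at one of them, then some `m`-th difference
of `f` on the grid is negative. -/
theorem exists_iterate_dOp_neg (h x : ℝ) (m : ℕ) (f : ℝ → ℝ) (k : ℕ → ℕ)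
    (hk : ∀ i < m, k i < k (i + 1))
    (hle : ∀ i ≤ m, (-1) ^ (m + i) * f (x + h * k i) ≤ 0)
    (hlt : ∃ i ≤ m, (-1) ^ (m + i) * f (x + h * k i) < 0) :
    ∃ j, k 0 ≤ j ∧ j + m ≤ k m ∧ (dOp h)^[m] f (x + h * j) < 0 := by
  induction m generalizing f k with
  | zero =>
    obtain ⟨i, hi, hlt⟩ := hlt
    obtain rfl : i = 0 := by omega
    exact ⟨k 0, le_rfl, le_rfl, by simpa using hlt⟩
  | succ m ih =>
    have hex : ∀ i, ∃ l, i ≤ m → k i ≤ l ∧ l < k (i + 1) ∧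
        ((k (i + 1) : ℝ) - k i) * ((-1) ^ (m + i) * dOp h f (x + h * l)) ≤
          (-1) ^ (m + 1 + (i + 1)) * f (x + h * k (i + 1)) +
            (-1) ^ (m + 1 + i) * f (x + h * k i) := by
      intro i
      by_cases hi : i ≤ m
      · obtain ⟨l, h1, h2, h3⟩ := exists_increment_le
          (fun j => (-1) ^ (m + i) * f (x + h * j)) (hk i (by omega))
        refine ⟨l, fun _ => ⟨h1, h2, ?_⟩⟩
        have e : x + h * ((l + 1 : ℕ) : ℝ) = x + h * l + h := by push_cast; ring
        rw [e] at h3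
        calc _ = ((k (i + 1) : ℝ) - k i) * ((-1) ^ (m + i) * f (x + h * l + h) -
              (-1) ^ (m + i) * f (x + h * l)) := by simp only [dOp]; ring
          _ ≤ _ := h3
          _ = _ := by ring
      · exact ⟨0, fun h' => absurd h' hi⟩
    choose l hl using hex
    have hpos : ∀ i ≤ m, (0 : ℝ) < (k (i + 1) : ℝ) - k i := fun i hi =>
      sub_pos.2 (by exact_mod_cast hk i (by omega))
    obtain ⟨j, hj0, hjm, hj⟩ := ih (dOp h f) l
      (fun i hi => (hl i hi.le).2.1.trans_le (hl (i + 1) hi).1)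
      (fun i hi => by
        have h1 := hle i (by omega)
        have h2 := hle (i + 1) (by omega)
        have h3 := (hl i hi).2.2
        exact nonpos_of_mul_nonpos_right (h3.trans (add_nonpos h2 h1)) (hpos i hi))
      (by
        obtain ⟨i, hi, hneg⟩ := hlt
        rcases hi.eq_or_lt with rfl | hi
        · have h3 := (hl m le_rfl).2.2
          exact ⟨m, le_rfl, (pos_iff_neg_of_mul_neg
            (h3.trans_lt (add_neg_of_neg_of_nonpos hneg (hle m (by omega))))).1 (hpos m le_rfl)⟩
        · have hi' : i ≤ m := by omega
          have h3 := (hl i hi').2.2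
          exact ⟨i, hi', (pos_iff_neg_of_mul_neg
            (h3.trans_lt (add_neg_of_nonpos_of_neg (hle (i + 1) (by omega)) hneg))).1
            (hpos i hi')⟩)
    refine ⟨j, (hl 0 (by omega)).1.trans hj0, ?_, by rwa [Function.iterate_succ_apply]⟩
    have := (hl m le_rfl).2.1
    omega

theorem iterate_dOp_mul (h : ℝ) (k : ℕ) (f : ℝ → ℝ) (y : ℝ) :
    (dOp h)^[k] f (h * y) = (dOp 1)^[k] (fun t => f (h * t)) y := by
  induction k generalizing f with
  | zero => rfl
  | succ k ih =>
    rw [Function.iterate_succ_apply, Function.iterate_succ_apply, ih]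
    have e : (fun t => dOp h f (h * t)) = dOp 1 fun t => f (h * t) := by
      ext t
      simp [dOp, mul_add]
    rw [e]

theorem iterate_dOp_eval_eq_zero {h : ℝ} (hh : h ≠ 0) {P : Polynomial ℝ} {k : ℕ}
    (hP : P.natDegree < k) (x : ℝ) : (dOp h)^[k] (fun t => P.eval t) x = 0 := by
  have hQ : (P.comp (Polynomial.C h * Polynomial.X)).natDegree < k := by
    rwa [Polynomial.natDegree_comp, Polynomial.natDegree_C_mul_X h hh, mul_one]
  have h0 := congrFun (Polynomial.fwdDiff_iter_eq_zero_of_degree_lt hQ) (x / h)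
  rw [← mul_div_cancel₀ x hh, iterate_dOp_mul, dOp_eq_fwdDiff]
  simpa [Function.comp_def] using h0

theorem JensenConvexOrder.sub_eval {n : ℕ} {I : Set ℝ} {f : ℝ → ℝ}
    (hf : JensenConvexOrder n I f) {P : Polynomial ℝ} (hP : P.natDegree < n + 1) :
    JensenConvexOrder n I (fun t => f t - P.eval t) := by
  intro h hh x hx hx'
  have e : f = (fun t => f t - P.eval t) + fun t => P.eval t := by ext; simp
  have h1 := hf h hh x hx hx'
  rw [e, dOp_eq_fwdDiff, fwdDiff_iter_add, ← dOp_eq_fwdDiff, Pi.add_apply,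
    iterate_dOp_eval_eq_zero hh.ne' hP, add_zero] at h1
  exact h1

theorem JensenConvexOrder.not_alternating {n : ℕ} {I : Set ℝ} {f : ℝ → ℝ}
    (hf : JensenConvexOrder n I f) (hI : I.OrdConnected) {h x : ℝ} (hh : 0 < h) {k : ℕ → ℕ}
    (hk : ∀ i < n + 1, k i < k (i + 1)) (hx : x + h * k 0 ∈ I) (hx' : x + h * k (n + 1) ∈ I)
    (hle : ∀ i ≤ n + 1, (-1) ^ (n + 1 + i) * f (x + h * k i) ≤ 0) :
    ∀ i ≤ n + 1, (-1) ^ (n + 1 + i) * f (x + h * k i) = 0 := by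
  by_contra! hne
  obtain ⟨i, hi, hne⟩ := hne
  obtain ⟨j, h0, h1, hneg⟩ := exists_iterate_dOp_neg h x (n + 1) f k hk hle
    ⟨i, hi, lt_of_le_of_ne (hle i hi) hne⟩
  have h0' : (k 0 : ℝ) ≤ j := by exact_mod_cast h0
  have h1' : (j : ℝ) + (n + 1) ≤ k (n + 1) := by exact_mod_cast h1
  have e : x + h * j + (n + 1) * h = x + h * (j + (n + 1)) := by ring
  have m0 : h * k 0 ≤ h * j := by gcongr
  have m1 : h * (j + (n + 1)) ≤ h * k (n + 1) := by gcongr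
  have m2 : h * j ≤ h * (j + (n + 1)) := by gcongr; linarith [n.cast_nonneg (α := ℝ)]
  refine hneg.not_ge (hf h hh _ (hI.out hx hx' ⟨?_, ?_⟩) ?_)
  · linarith
  · linarith
  · rw [e]
    exact hI.out hx hx' ⟨by linarith, by linarith⟩

theorem exists_polynomial_interpolating (n : ℕ) (f : ℝ → ℝ) {r d : ℝ} (hd : d ≠ 0) {w : ℕ → ℕ}
    (hw : Set.InjOn w (Finset.range (n + 1))) :
    ∃ P : Polynomial ℝ, P.natDegree < n + 1 ∧
      ∀ i ≤ n, P.eval (r + d * w i) = f (r + d * w i) := by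
  have hv : Set.InjOn (fun i => r + d * (w i : ℝ)) (Finset.range (n + 1)) := by
    intro i hi j hj hij
    have : d * (w i : ℝ) = d * w j := add_left_cancel hij
    exact hw hi hj (by exact_mod_cast mul_left_cancel₀ hd this)
  refine ⟨Lagrange.interpolate (Finset.range (n + 1)) (fun i => r + d * (w i : ℝ))
    (fun i => f (r + d * w i)), ?_, fun i hi =>
      Lagrange.eval_interpolate_at_node _ hv (Finset.mem_range.2 (by omega))⟩
  have := Lagrange.degree_interpolate_lt (fun i => f (r + d * w i)) hv
  rw [Finset.card_range] at this
  exact Nat.lt_succ_of_le (Polynomial.natDegree_le_of_degree_le (Order.le_of_lt_succ this))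

/-- An n-Jensen convex function is bounded on the rational points of every compact
subinterval of I. -/
theorem jensen_convex_rational_bounded (n : ℕ) (hn : 1 ≤ n) (I : Set ℝ)
    (hI : ProperOpenInterval I) (f : ℝ → ℝ) (hf : JensenConvexOrder n I f) :
    ∀ a b : ℝ, a ≤ b → Set.Icc a b ⊆ I →
      ∃ K : ℝ, 0 ≤ K ∧ ∀ x ∈ Set.Icc a b, IsRatR x → |f x| ≤ K := by
  intro a b hab hsub
  obtain ⟨hopen, hord, -, -⟩ := hI
  obtain ⟨l, u, ⟨hla, hau⟩, hlu⟩ := (mem_nhds_iff_exists_Ioo_subset).1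
    (hopen.mem_nhds (hsub ⟨le_rfl, hab⟩))
  obtain ⟨l', u', ⟨hlb, hbu⟩, hlu'⟩ := (mem_nhds_iff_exists_Ioo_subset).1
    (hopen.mem_nhds (hsub ⟨hab, le_rfl⟩))
  obtain ⟨r, hlr, hra⟩ := exists_rat_btwn hla
  obtain ⟨q, hbq, hqu⟩ := exists_rat_btwn hbu
  have hrI : (r : ℝ) ∈ I := hlu ⟨hlr, hra.trans hau⟩
  have hqI : (q : ℝ) ∈ I := hlu' ⟨hlb.trans hbq, hqu⟩
  have hrq : (0 : ℝ) < q - r := by linarith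
  obtain ⟨N, hN⟩ := exists_nat_gt (n * ((q : ℝ) - r) / (a - r))
  have har : (0 : ℝ) < a - r := by linarith
  have hN0 : (0 : ℝ) < N := lt_of_le_of_lt (by positivity) hN
  set d : ℝ := ((q : ℝ) - r) / N with hd
  have hdpos : 0 < d := by positivity
  have hdN : d * N = q - r := div_mul_cancel₀ _ hN0.ne'
  have hnd : d * n < a - r := by
    rw [div_lt_iff₀ har] at hN
    rw [hd, div_mul_eq_mul_div, div_lt_iff₀ hN0]
    linarith
  have hnN : n < N := by
    have : d * n < d * N := by linarith
    exact_mod_cast lt_of_mul_lt_mul_left this hdpos.le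
  obtain ⟨P₁, hP₁, hP₁e⟩ := exists_polynomial_interpolating n f (r := r) hdpos.ne' (w := id)
    (fun _ _ _ _ h => h)
  obtain ⟨P₂, hP₂, hP₂e⟩ := exists_polynomial_interpolating n f (r := r) hdpos.ne'
    (w := fun i => if i < n then i else N) (by
      intro i hi j hj hij
      simp only [Finset.coe_range, Set.mem_Iio] at hi hj
      dsimp only at hij
      split_ifs at hij <;> omega)
  obtain ⟨K₁, hK₁⟩ := isCompact_Icc.exists_bound_of_continuousOn
    (s := Set.Icc a b) P₁.continuous.continuousOn
  obtain ⟨K₂, hK₂⟩ := isCompact_Icc.exists_bound_of_continuousOn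
    (s := Set.Icc a b) P₂.continuous.continuousOn
  refine ⟨max 0 (max K₁ K₂), le_max_left _ _, ?_⟩
  rintro _ hx ⟨x, rfl⟩
  suffices hb : P₁.eval (x : ℝ) ≤ f x ∧ f x ≤ P₂.eval (x : ℝ) by
    have h1 := (abs_le.1 (hK₁ x hx)).1
    have h2 := (abs_le.1 (hK₂ x hx)).2
    have h3 : K₁ ≤ max 0 (max K₁ K₂) := by simp
    have h4 : K₂ ≤ max 0 (max K₁ K₂) := by simp
    exact abs_le.2 ⟨by linarith [hb.1], by linarith [hb.2]⟩
  obtain ⟨A, B, hB, hAB⟩ : ∃ A B : ℕ, 0 < B ∧ d * A = (x - r) * B := by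
    have hrx : (r : ℝ) < x := hra.trans_le hx.1
    have hrq' : r < q := by exact_mod_cast sub_pos.1 hrq
    have hrx' : r < x := by exact_mod_cast hrx
    have hNq : (0 : ℚ) < N := by exact_mod_cast hN0
    set t : ℚ := (x - r) * N / (q - r) with ht
    have htpos : 0 < t := div_pos (mul_pos (sub_pos.2 hrx') hNq) (sub_pos.2 hrq')
    have hnum : ((t.num.toNat : ℕ) : ℚ) = t * t.den := by
      rw [Rat.mul_den_eq_num]
      exact_mod_cast Int.toNat_of_nonneg (Rat.num_pos.2 htpos).le
    refine ⟨t.num.toNat, t.den, t.den_pos, ?_⟩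
    have hnum' : ((t.num.toNat : ℕ) : ℝ) = t * t.den := by exact_mod_cast hnum
    have ht' : (t : ℝ) = (x - r) * N / (q - r) := by rw [ht]; push_cast; rfl
    rw [hnum', ← mul_assoc, ht', hd]
    field_simp
  have hB' : (0 : ℝ) < B := by exact_mod_cast hB
  set h : ℝ := d / B with hh
  have hhpos : 0 < h := by positivity
  have hgrid : ∀ i : ℕ, (r : ℝ) + h * ((i * B : ℕ) : ℝ) = r + d * i := by
    intro i
    rw [hh]
    push_cast
    field_simp
  have hgridA : (r : ℝ) + h * A = x := by
    rw [hh, div_mul_eq_mul_div, hAB, mul_div_cancel_right₀ _ hB'.ne']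
    ring
  have hnA : n * B < A := by
    have : h * ((n * B : ℕ) : ℝ) < h * A := by linarith [hgrid n, hx.1]
    exact_mod_cast lt_of_mul_lt_mul_left this hhpos.le
  have hAN : A < N * B := by
    have : h * A < h * ((N * B : ℕ) : ℝ) := by linarith [hgrid N, hx.2]
    exact_mod_cast lt_of_mul_lt_mul_left this hhpos.le
  have hstep : ∀ i, i * B < (i + 1) * B := fun i => by gcongr; omega
  constructor
  · by_contra! hlt
    have key := (hf.sub_eval hP₁).not_alternating hord hhpos (x := r)
      (k := fun i => if i ≤ n then i * B else A)
      (fun i hi => by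
        rcases (Nat.lt_succ_iff.1 hi).eq_or_lt with rfl | hi
        · simpa using hnA
        · simpa [hi.le, Nat.succ_le_iff.2 hi] using hstep i)
      (by simpa using hrI)
      (by simpa [hgridA] using hsub hx)
      (fun i hi => by
        rcases hi.eq_or_lt with rfl | hi
        · simp [hgridA, ← two_mul, hlt.le]
        · have hi' : i ≤ n := by omega
          simp only [hi', if_true, hgrid]
          have : f (r + d * i) = P₁.eval (r + d * i) := (hP₁e i hi').symm
          simp [this])
      (n + 1) le_rfl
    simp [hgridA, ← two_mul] at key
    linarith
  · by_contra! hlt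
    have hzero : ∀ i ≤ n, f (r + d * ((if i < n then i else N : ℕ) : ℝ)) -
        P₂.eval (r + d * ((if i < n then i else N : ℕ) : ℝ)) = 0 := fun i hi =>
      sub_eq_zero.2 (hP₂e i hi).symm
    have key := (hf.sub_eval hP₂).not_alternating hord hhpos (x := r)
      (k := fun i => if i < n then i * B else if i = n then A else N * B)
      (fun i hi => by
        rcases lt_trichotomy (i + 1) n with h | rfl | h
        · simpa [h, show i < n by omega] using hstep i
        · have := hstep i
          simp
          omega
        · obtain rfl : i = n := by omega
          simpa using hAN)
      (by simpa [show 0 < n by omega] using hrI)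
      (by simpa only [show ¬ n + 1 < n by omega, show n + 1 ≠ n by omega, if_false, hgrid, hdN,
            add_sub_cancel] using hqI)
      (fun i hi => by
        rcases lt_trichotomy i n with h | rfl | h
        · have := hzero i h.le
          simp only [h, if_true] at this
          simp only [h, if_true, hgrid, this, mul_zero, le_refl]
        · simp only [lt_irrefl, if_false, if_true, hgridA]
          have e : (-1 : ℝ) ^ (i + 1 + i) = -1 := Odd.neg_one_pow ⟨i, by omega⟩
          rw [e]
          linarith
        · have := hzero n le_rfl
          simp only [lt_irrefl, if_false] at this
          simp only [h.not_gt, h.ne', if_false, hgrid, this, mul_zero, le_refl])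
      n (by omega)
    simp [hgridA] at key
    linarith
end
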